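/- arXiv:1211.4754 — 4 statements merged into one kernel-verified Lean document; each statement's English description precedes it below -/
import Mathlib

section
/- Let A = (A_1,…,A_q) be a system of endomorphisms of V and let u ∈ ℕ^q. Then for every differentiable curve τ ↦ A(τ) = (A_1(τ),…,A_q(τ)) in End(V)^q with A(0) = A, one has d/dτ σ_u(A(τ))|_{τ=0} = Σ_{α=1}^q tr( (d/dτ A_α(τ)|_{τ=0}) ∘ T_{α♭(u)}(A) ). In other words, the family (T_u(A))_{u∈ℕ^q} given by the explicit formula satisfies the defining variational property of the generalized Newton transformation. -/
open scoped BigOperators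

namespace GNTPaper

variable {p q : ℕ}

/-- The Newton polynomial `P_A(t) = det(1_V + tA)` of a system of endomorphisms
(represented as matrices w.r.t. an orthonormal basis), as a multivariate
polynomial in the variables `t_1, …, t_q`. -/
noncomputable def newtonMvPoly (A : Fin q → Matrix (Fin p) (Fin p) ℝ) :
    MvPolynomial (Fin q) ℝ :=
  Matrix.det (1 + ∑ α : Fin q, (MvPolynomial.X α : MvPolynomial (Fin q) ℝ) •
    (A α).map (fun x => (MvPolynomial.C x : MvPolynomial (Fin q) ℝ)))

/-- `σ_u(A)`: the coefficient of `t^u` in the Newton polynomial `P_A(t) = det(1 + tA)`. -/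
noncomputable def sigma (A : Fin q → Matrix (Fin p) (Fin p) ℝ) (u : Fin q → ℕ) : ℝ :=
  MvPolynomial.coeff (Finsupp.equivFunOnFinite.symm u) (newtonMvPoly A)

/-- A matrix `i ∈ I(q,s)` (a `q × s` matrix of zeros and ones with exactly one `1`
in each column) is encoded by the function `c : Fin s → Fin q` recording, for each
column `l`, the row `c l` containing its unique entry `1`.  `wt c α` is then the
weight `|i^α| = Σ_l i^α_l`, i.e. the number of columns whose `1` lies in row `α`. -/
def wt {s : ℕ} (c : Fin s → Fin q) (α : Fin q) : ℕ :=
  (Finset.univ.filter fun l => c l = α).card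

/-- The ordered composition `A^i = A_{c(1)} ⬝ A_{c(2)} ⬝ ⋯ ⬝ A_{c(s)}` associated to a
matrix `i ∈ I(q,s)` encoded by `c : Fin s → Fin q` (`A^i = 1` for `s = 0`). -/
noncomputable def prodSeq (A : Fin q → Matrix (Fin p) (Fin p) ℝ) {s : ℕ}
    (c : Fin s → Fin q) : Matrix (Fin p) (Fin p) ℝ :=
  (List.ofFn fun l => A (c l)).prod

/-- `σ_{u - |i|}(A)`, where by convention it is `0` whenever `u - |i|` has a
negative entry. -/
noncomputable def sigmaSub (A : Fin q → Matrix (Fin p) (Fin p) ℝ) (u : Fin q → ℕ)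
    {s : ℕ} (c : Fin s → Fin q) : ℝ :=
  if ∀ α, wt c α ≤ u α then sigma A (fun α => u α - wt c α) else 0

/-- The generalized Newton transformation
`T_u(A) = Σ_{s=0}^{|u|} Σ_{i ∈ I(q,s)} (-1)^{‖i‖} σ_{u-|i|}(A) A^i`. -/
noncomputable def gnt (A : Fin q → Matrix (Fin p) (Fin p) ℝ) (u : Fin q → ℕ) :
    Matrix (Fin p) (Fin p) ℝ :=
  ∑ s ∈ Finset.range ((∑ α, u α) + 1),
    (-1 : ℝ) ^ s • ∑ c : Fin s → Fin q, sigmaSub A u c • prodSeq A c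

/-- `T_{α♭(u)}(A)`, with the convention that it is `0` when `u α = 0`. -/
noncomputable def gntFlat (A : Fin q → Matrix (Fin p) (Fin p) ℝ) (α : Fin q)
    (u : Fin q → ℕ) : Matrix (Fin p) (Fin p) ℝ :=
  if u α = 0 then 0 else gnt A (Function.update u α (u α - 1))

/-- `σ_{α♭(u)}(A)`, with the convention that it is `0` when `u α = 0`. -/
noncomputable def sigmaFlat (A : Fin q → Matrix (Fin p) (Fin p) ℝ) (α : Fin q)
    (u : Fin q → ℕ) : ℝ :=
  if u α = 0 then 0 else sigma A (Function.update u α (u α - 1))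

/-- The generalized Kronecker symbol `δ^{i_1…i_r}_{j_1…j_r}`, equal to `+1` (resp. `-1`)
if the `i`'s are distinct and the `j`'s are an even (resp. odd) permutation of the `i`'s,
and `0` otherwise; given by the classical determinant formula `det(δ_{i_k j_l})_{k,l}`. -/
noncomputable def gkron {n r : ℕ} (i j : Fin r → Fin n) : ℝ :=
  Matrix.det (Matrix.of fun k l : Fin r => if i k = j l then (1 : ℝ) else 0)

/-- For `k < 2m`, the index `⌊k/2⌋ < m`; used to pair consecutive indices. -/
def halfIdx {m : ℕ} (k : Fin (2 * m)) : Fin m :=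
  ⟨(k : ℕ) / 2, Nat.div_lt_of_lt_mul k.isLt⟩

/-- The scalar `S_r(A)` (for `r = 2m` even) from Reilly's construction. -/
noncomputable def Sr (A : Fin q → Matrix (Fin p) (Fin p) ℝ) (m : ℕ) : ℝ :=
  (1 / ((2 * m).factorial : ℝ)) *
    ∑ iv : Fin (2 * m) → Fin p, ∑ jv : Fin (2 * m) → Fin p,
      gkron iv jv * ∑ a : Fin m → Fin q, ∏ k : Fin (2 * m), A (a (halfIdx k)) (iv k) (jv k)

/-- The Reilly operator `T_r(A)` (for `r = 2m` even). -/
noncomputable def TrReilly (A : Fin q → Matrix (Fin p) (Fin p) ℝ) (m : ℕ) :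
    Matrix (Fin p) (Fin p) ℝ :=
  Matrix.of fun i j => (1 / ((2 * m).factorial : ℝ)) *
    ∑ iv : Fin (2 * m) → Fin p, ∑ jv : Fin (2 * m) → Fin p,
      gkron (Fin.snoc iv i) (Fin.snoc jv j) *
        ∑ a : Fin m → Fin q, ∏ k : Fin (2 * m), A (a (halfIdx k)) (iv k) (jv k)

/-- The Reilly operator `T_{r+1}^α(A)` (for `r = 2m` even). -/
noncomputable def Tr1Reilly (A : Fin q → Matrix (Fin p) (Fin p) ℝ) (m : ℕ) (α : Fin q) :
    Matrix (Fin p) (Fin p) ℝ :=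
  Matrix.of fun i j => (1 / ((2 * m).factorial : ℝ)) *
    ∑ iv : Fin (2 * m + 1) → Fin p, ∑ jv : Fin (2 * m + 1) → Fin p,
      gkron (Fin.snoc iv i) (Fin.snoc jv j) *
        (A α (iv (Fin.last (2 * m))) (jv (Fin.last (2 * m))) *
          ∑ a : Fin m → Fin q, ∏ k : Fin (2 * m),
            A (a (halfIdx k)) (iv k.castSucc) (jv k.castSucc))

/-- The (finite) set of multi-indices `u ∈ 2ℕ(q)` with `|u| = r` (all entries even,
total length `r`). -/
noncomputable def evenIdx (q r : ℕ) : Finset (Fin q → ℕ) :=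
  (Fintype.piFinset fun _ : Fin q => Finset.range (r + 1)).filter
    fun u => (∀ α, Even (u α)) ∧ ∑ α, u α = r

/-- Coefficientwise differentiability at `x` of a curve of multivariate polynomials. -/
def HasCoeffDerivAt {ι : Type*} (f : ℝ → MvPolynomial ι ℝ) (f' : MvPolynomial ι ℝ) (x : ℝ) :
    Prop :=
  ∀ m, HasDerivAt (fun τ => (f τ).coeff m) (f'.coeff m) x

namespace HasCoeffDerivAt

variable {ι κ : Type*} {x : ℝ}

theorem const (P : MvPolynomial ι ℝ) : HasCoeffDerivAt (fun _ => P) 0 x := fun m => by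
  simpa using hasDerivAt_const x (P.coeff m)

theorem add {f g : ℝ → MvPolynomial ι ℝ} {f' g' : MvPolynomial ι ℝ}
    (hf : HasCoeffDerivAt f f' x) (hg : HasCoeffDerivAt g g' x) :
    HasCoeffDerivAt (fun τ => f τ + g τ) (f' + g') x := fun m => by
  simpa only [MvPolynomial.coeff_add] using (hf m).fun_add (hg m)

theorem mul {f g : ℝ → MvPolynomial ι ℝ} {f' g' : MvPolynomial ι ℝ}
    (hf : HasCoeffDerivAt f f' x) (hg : HasCoeffDerivAt g g' x) :
    HasCoeffDerivAt (fun τ => f τ * g τ) (f' * g x + f x * g') x := fun m => by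
  classical
  simp only [MvPolynomial.coeff_add, MvPolynomial.coeff_mul, ← Finset.sum_add_distrib]
  exact HasDerivAt.fun_sum fun k _ => (hf k.1).fun_mul (hg k.2)

theorem const_mul {f : ℝ → MvPolynomial ι ℝ} {f' : MvPolynomial ι ℝ} (P : MvPolynomial ι ℝ)
    (hf : HasCoeffDerivAt f f' x) : HasCoeffDerivAt (fun τ => P * f τ) (P * f') x := by
  simpa using (const P).mul hf

theorem C {f : ℝ → ℝ} {f' : ℝ} (hf : HasDerivAt f f' x) :
    HasCoeffDerivAt (fun τ => (MvPolynomial.C (f τ) : MvPolynomial ι ℝ))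
      (MvPolynomial.C f') x := fun m => by
  classical
  simp only [MvPolynomial.coeff_C]
  split_ifs
  · exact hf
  · exact hasDerivAt_const x 0

theorem sum {f : κ → ℝ → MvPolynomial ι ℝ} {f' : κ → MvPolynomial ι ℝ} {s : Finset κ}
    (hf : ∀ k ∈ s, HasCoeffDerivAt (f k) (f' k) x) :
    HasCoeffDerivAt (fun τ => ∑ k ∈ s, f k τ) (∑ k ∈ s, f' k) x := fun m => by
  simp only [MvPolynomial.coeff_sum]
  exact HasDerivAt.fun_sum fun k hk => hf k hk m

theorem prod [DecidableEq κ] {f : κ → ℝ → MvPolynomial ι ℝ} {f' : κ → MvPolynomial ι ℝ}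
    {s : Finset κ} (hf : ∀ k ∈ s, HasCoeffDerivAt (f k) (f' k) x) :
    HasCoeffDerivAt (fun τ => ∏ k ∈ s, f k τ)
      (∑ k ∈ s, (∏ l ∈ s.erase k, f l x) * f' k) x := by
  induction s using Finset.induction_on with
  | empty => simpa using const (x := x) (1 : MvPolynomial ι ℝ)
  | insert a s ha ih =>
    have h := (hf a (Finset.mem_insert_self a s)).mul
      (ih fun k hk => hf k (Finset.mem_insert_of_mem hk))
    simp only [Finset.prod_insert ha]
    convert h using 1
    rw [Finset.sum_insert ha, Finset.erase_insert ha, mul_comm, Finset.mul_sum]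
    congr 1
    refine Finset.sum_congr rfl fun k hk => ?_
    have hka : a ≠ k := fun h => ha (h ▸ hk)
    rw [Finset.erase_insert_of_ne hka,
      Finset.prod_insert fun h => ha (Finset.mem_of_mem_erase h), mul_assoc]

/-- Jacobi's formula. -/
theorem det [Fintype κ] [DecidableEq κ] {M : ℝ → Matrix κ κ (MvPolynomial ι ℝ)}
    {M' : Matrix κ κ (MvPolynomial ι ℝ)}
    (hM : ∀ i j, HasCoeffDerivAt (fun τ => M τ i j) (M' i j) x) :
    HasCoeffDerivAt (fun τ => (M τ).det) (Matrix.trace (M' * (M x).adjugate)) x := by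
  simp only [Matrix.det_apply']
  have hσ (σ : Equiv.Perm κ) :=
    const_mul ((σ.sign : ℤ) : MvPolynomial ι ℝ)
      (prod (s := Finset.univ) fun i _ => hM (σ i) i)
  convert HasCoeffDerivAt.sum (s := Finset.univ) fun σ _ => hσ σ using 1
  have hcol (i : κ) : ((M x).adjugate * M') i i = ((M x).updateCol i (M'.col i)).det := by
    rw [← Matrix.cramer_apply, Matrix.cramer_eq_adjugate_mulVec]
    rfl
  rw [Matrix.trace_mul_comm]
  simp only [Matrix.trace, Matrix.diag_apply, hcol,
    Matrix.det_apply', Finset.mul_sum]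
  rw [Finset.sum_comm]
  refine Finset.sum_congr rfl fun σ _ => Finset.sum_congr rfl fun i _ => ?_
  rw [← Finset.prod_erase_mul _ _ (Finset.mem_univ i), Matrix.updateCol_self]
  congr 2
  exact Finset.prod_congr rfl fun j hj => Matrix.updateCol_ne (Finset.ne_of_mem_erase hj)

end HasCoeffDerivAt

/-- The matrix `1 + tA` over the polynomial ring in `t`. -/
noncomputable def newtonMatrix (A : Fin q → Matrix (Fin p) (Fin p) ℝ) :
    Matrix (Fin p) (Fin p) (MvPolynomial (Fin q) ℝ) :=
  1 + ∑ α : Fin q, (MvPolynomial.X α : MvPolynomial (Fin q) ℝ) •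
    (A α).map (fun x => (MvPolynomial.C x : MvPolynomial (Fin q) ℝ))

theorem newtonMatrix_apply (A : Fin q → Matrix (Fin p) (Fin p) ℝ) (i j : Fin p) :
    newtonMatrix A i j = (1 : Matrix (Fin p) (Fin p) (MvPolynomial (Fin q) ℝ)) i j +
      ∑ α, MvPolynomial.X α * MvPolynomial.C (A α i j) := by
  simp [newtonMatrix, Matrix.sum_apply]

theorem coeff_X_mul_equivFunOnFinite (v : Fin q → ℕ) (α : Fin q) (P : MvPolynomial (Fin q) ℝ) :
    (MvPolynomial.X α * P).coeff (Finsupp.equivFunOnFinite.symm v) =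
      if v α = 0 then 0 else
        P.coeff (Finsupp.equivFunOnFinite.symm (Function.update v α (v α - 1))) := by
  rw [MvPolynomial.coeff_X_mul']
  by_cases h : v α = 0
  · simp [h]
  · rw [if_pos (by simpa using h), if_neg h]
    congr 1
    ext β
    by_cases hβ : β = α
    · subst hβ; simp
    · simp [hβ]

theorem wt_cons {s : ℕ} (α : Fin q) (c : Fin s → Fin q) (β : Fin q) :
    wt (Fin.cons α c : Fin (s + 1) → Fin q) β = (if α = β then 1 else 0) + wt c β := by
  simp only [wt, Finset.card_filter, Fin.sum_univ_succ, Fin.cons_zero, Fin.cons_succ]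

theorem sigmaSub_cons (A : Fin q → Matrix (Fin p) (Fin p) ℝ) (v : Fin q → ℕ) {s : ℕ}
    (α : Fin q) (c : Fin s → Fin q) :
    sigmaSub A v (Fin.cons α c : Fin (s + 1) → Fin q) =
      if v α = 0 then 0 else sigmaSub A (Function.update v α (v α - 1)) c := by
  unfold sigmaSub
  simp only [wt_cons]
  by_cases h : v α = 0
  · rw [if_pos h, if_neg]
    intro hle
    have := hle α
    simp [h] at this
  · rw [if_neg h]
    have hiff (β : Fin q) : (if α = β then 1 else 0) + wt c β ≤ v β ↔
        wt c β ≤ Function.update v α (v α - 1) β := by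
      by_cases hβ : α = β
      · subst hβ
        simp only [if_true, Function.update_self]
        omega
      · simp [hβ, Ne.symm hβ]
    have hsub : (fun β => v β - ((if α = β then 1 else 0) + wt c β)) =
        fun β => Function.update v α (v α - 1) β - wt c β := by
      funext β
      by_cases hβ : α = β
      · subst hβ
        simp only [if_true, Function.update_self]
        omega
      · simp [hβ, Ne.symm hβ]
    simp only [hiff, hsub]

theorem prodSeq_cons (A : Fin q → Matrix (Fin p) (Fin p) ℝ) {s : ℕ} (α : Fin q)
    (c : Fin s → Fin q) :
    prodSeq A (Fin.cons α c : Fin (s + 1) → Fin q) = A α * prodSeq A c := by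
  simp [prodSeq, List.ofFn_succ]

theorem sum_update_pred (v : Fin q → ℕ) {α : Fin q} (h : v α ≠ 0) :
    ∑ β, Function.update v α (v α - 1) β + 1 = ∑ β, v β := by
  rw [Finset.sum_update_of_mem (Finset.mem_univ α), ← Finset.add_sum_erase _ v (Finset.mem_univ α),
    Finset.sdiff_singleton_eq_erase]
  omega

theorem sigmaSub_fin_zero (A : Fin q → Matrix (Fin p) (Fin p) ℝ) (v : Fin q → ℕ)
    (c : Fin 0 → Fin q) : sigmaSub A v c = sigma A v := by
  simp [sigmaSub, wt]

theorem gnt_eq_sub (A : Fin q → Matrix (Fin p) (Fin p) ℝ) (v : Fin q → ℕ) :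
    gnt A v = sigma A v • 1 - ∑ α, A α * gntFlat A α v := by
  rw [gnt, Finset.sum_range_succ', add_comm, sub_eq_add_neg]
  congr 1
  · simp [sigmaSub_fin_zero, prodSeq]
  · rw [← Finset.sum_neg_distrib]
    simp only [← (Fin.consEquiv fun _ => Fin q).sum_comp, Fintype.sum_prod_type, Fin.consEquiv,
      Equiv.coe_fn_mk, sigmaSub_cons, prodSeq_cons, Finset.smul_sum]
    rw [Finset.sum_comm]
    refine Finset.sum_congr rfl fun α _ => ?_
    by_cases h : v α = 0
    · simp [h, gntFlat]
    · simp only [h, gntFlat, if_false, gnt, sum_update_pred v h, Matrix.mul_sum,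
        Matrix.mul_smul, Finset.smul_sum, ← Finset.sum_neg_distrib]
      refine Finset.sum_congr rfl fun s _ => Finset.sum_congr rfl fun c _ => ?_
      rw [pow_succ, mul_neg_one, neg_smul]

theorem coeff_newtonMatrix_mul (A : Fin q → Matrix (Fin p) (Fin p) ℝ) (v : Fin q → ℕ)
    (B : Matrix (Fin p) (Fin p) (MvPolynomial (Fin q) ℝ)) :
    (newtonMatrix A * B).map (MvPolynomial.coeff (Finsupp.equivFunOnFinite.symm v)) =
      B.map (MvPolynomial.coeff (Finsupp.equivFunOnFinite.symm v)) +
      ∑ α, A α * if v α = 0 then 0 else B.map (MvPolynomial.coeff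
        (Finsupp.equivFunOnFinite.symm (Function.update v α (v α - 1)))) := by
  ext i j
  simp only [newtonMatrix, add_mul, one_mul, Finset.sum_mul, Matrix.smul_mul, Matrix.map_apply,
    Matrix.add_apply, Matrix.sum_apply, Matrix.smul_apply, smul_eq_mul, MvPolynomial.coeff_add,
    MvPolynomial.coeff_sum, coeff_X_mul_equivFunOnFinite]
  congr 1
  refine Finset.sum_congr rfl fun α _ => ?_
  split_ifs
  · simp
  · simp [Matrix.mul_apply, MvPolynomial.coeff_sum, MvPolynomial.coeff_C_mul]

theorem coeff_adjugate_newtonMatrix (A : Fin q → Matrix (Fin p) (Fin p) ℝ) (v : Fin q → ℕ) :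
    (newtonMatrix A).adjugate.map (MvPolynomial.coeff (Finsupp.equivFunOnFinite.symm v)) =
      gnt A v := by
  have hσ : (newtonMatrix A * (newtonMatrix A).adjugate).map
      (MvPolynomial.coeff (Finsupp.equivFunOnFinite.symm v)) = sigma A v • 1 := by
    rw [Matrix.mul_adjugate]
    ext i j
    by_cases hij : i = j
    · subst hij
      simp [sigma, newtonMvPoly, newtonMatrix]
    · simp [hij]
  rw [gnt_eq_sub, ← hσ, coeff_newtonMatrix_mul, eq_sub_iff_add_eq]
  congr 1
  refine Finset.sum_congr rfl fun α _ => ?_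
  rw [gntFlat]
  split_ifs with h
  · rfl
  · rw [coeff_adjugate_newtonMatrix A (Function.update v α (v α - 1))]
termination_by ∑ β, v β
decreasing_by
  have := sum_update_pred v h
  omega

theorem statement_0 (hq : 1 ≤ q) (A : Fin q → Matrix (Fin p) (Fin p) ℝ) (u : Fin q → ℕ)
    (𝓐 : ℝ → Fin q → Matrix (Fin p) (Fin p) ℝ) (𝓐' : Fin q → Matrix (Fin p) (Fin p) ℝ)
    (h0 : 𝓐 0 = A)
    (hderiv : ∀ α i j, HasDerivAt (fun τ => 𝓐 τ α i j) (𝓐' α i j) 0) :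
    HasDerivAt (fun τ => sigma (𝓐 τ) u)
      (∑ α, Matrix.trace (𝓐' α * gntFlat A α u)) 0 := by
  subst h0
  have hM (i j : Fin p) : HasCoeffDerivAt (fun τ => newtonMatrix (𝓐 τ) i j)
      ((∑ α, (MvPolynomial.X α : MvPolynomial (Fin q) ℝ) •
        (𝓐' α).map (fun x => (MvPolynomial.C x : MvPolynomial (Fin q) ℝ))) i j) 0 := by
    have h := (HasCoeffDerivAt.const (x := 0)
      ((1 : Matrix (Fin p) (Fin p) (MvPolynomial (Fin q) ℝ)) i j)).add
      (HasCoeffDerivAt.sum (s := Finset.univ) fun α _ =>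
        (HasCoeffDerivAt.C (hderiv α i j)).const_mul (MvPolynomial.X α))
    simpa [newtonMatrix_apply, Matrix.sum_apply] using h
  have hdet : HasDerivAt (fun τ => sigma (𝓐 τ) u) _ 0 :=
    HasCoeffDerivAt.det hM (Finsupp.equivFunOnFinite.symm u)
  convert hdet using 1
  simp only [Finset.sum_mul, Matrix.trace_sum, Matrix.smul_mul, Matrix.trace_smul, smul_eq_mul,
    MvPolynomial.coeff_sum, coeff_X_mul_equivFunOnFinite]
  refine Finset.sum_congr rfl fun α _ => ?_
  rw [gntFlat]
  split_ifs
  · simp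
  · simp [← coeff_adjugate_newtonMatrix, Matrix.trace, Matrix.mul_apply, MvPolynomial.coeff_sum,
      MvPolynomial.coeff_C_mul]

end GNTPaper
end

section
/- Let τ ↦ A(τ) be a differentiable curve in End(V)^q, put A = A(0) and A' = d/dτ A(τ)|_{τ=0}. Then there exists ε > 0 such that for every t ∈ ℝ^q with |t| < ε, d/dτ P_{A(τ)}(t)|_{τ=0} = tr( tA' ∘ Σ_{s=0}^∞ (−1)^s Σ_{i∈I(q,s)} t^{|i|} A^i ) · P_A(t), where tA' = t_1A_1' + … + t_qA_q'. -/
open scoped BigOperators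

namespace GNTPaper

variable {p q : ℕ}

/-- Jacobi's formula for the derivative of a determinant. -/
theorem _root_.Matrix.hasDerivAt_det {n 𝕜 : Type*} [Fintype n] [DecidableEq n]
    [NontriviallyNormedField 𝕜] {M : 𝕜 → Matrix n n 𝕜} {M' : Matrix n n 𝕜} {x : 𝕜}
    (hM : ∀ i j, HasDerivAt (fun τ => M τ i j) (M' i j) x) :
    HasDerivAt (fun τ => (M τ).det) (M' * (M x).adjugate).trace x := by
  let f : ContinuousMultilinearMap 𝕜 (fun _ : n => n → 𝕜) 𝕜 :=
    ⟨(Matrix.detRowAlternating (R := 𝕜)).toMultilinearMap,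
      (continuous_id (X := Matrix n n 𝕜)).matrix_det⟩
  have hM₂ : HasDerivAt (fun τ i => M τ i) (fun i => M' i) x :=
    hasDerivAt_pi.2 fun i => hasDerivAt_pi.2 fun j => hM i j
  have h := (f.hasFDerivAt (fun i => M x i)).comp_hasDerivAt x hM₂
  have key : (M' * (M x).adjugate).trace = f.linearDeriv (fun i => M x i) (fun i => M' i) := by
    rw [ContinuousMultilinearMap.linearDeriv_apply, Matrix.trace]
    refine Finset.sum_congr rfl fun i _ => ?_
    change _ = ((M x).updateRow i (M' i)).det
    rw [← Matrix.cramer_transpose_apply, Matrix.cramer_eq_adjugate_mulVec,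
      ← Matrix.adjugate_transpose, Matrix.mulVec_transpose]
    rfl
  rw [key]
  exact h

/-- The noncommutative multinomial expansion of a power of a sum. -/
theorem sum_pow_eq_sum_prod_ofFn {ι R : Type*} [Fintype ι] [Semiring R] (B : ι → R) (s : ℕ) :
    (∑ a, B a) ^ s = ∑ c : Fin s → ι, (List.ofFn fun l => B (c l)).prod := by
  induction s with
  | zero => simp
  | succ s ih =>
    rw [pow_succ', ih, Finset.sum_mul_sum, ← (Fin.consEquiv fun _ => ι).sum_comp,
      Fintype.sum_prod_type]
    simp [Fin.consEquiv, List.ofFn_succ]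

theorem prod_ofFn_smul {R S : Type*} [CommSemiring R] [Semiring S] [Algebra R S] {s : ℕ}
    (r : Fin s → R) (B : Fin s → S) :
    (List.ofFn fun l => r l • B l).prod = (∏ l, r l) • (List.ofFn B).prod := by
  induction s with
  | zero => simp
  | succ s ih => simp [List.ofFn_succ, ih, Fin.prod_univ_succ, mul_smul, smul_comm (r 0)]

theorem prod_pow_wt (t : Fin q → ℝ) {s : ℕ} (c : Fin s → Fin q) :
    ∏ α, t α ^ wt c α = ∏ l, t (c l) := by
  rw [← Finset.prod_fiberwise' Finset.univ c t]
  simp [wt]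

theorem sum_smul_prodSeq (A : Fin q → Matrix (Fin p) (Fin p) ℝ) (t : Fin q → ℝ) (s : ℕ) :
    ∑ c : Fin s → Fin q, (∏ α, t α ^ wt c α) • prodSeq A c = (∑ α, t α • A α) ^ s := by
  simp_rw [sum_pow_eq_sum_prod_ofFn, prod_ofFn_smul, prod_pow_wt, prodSeq]

/-- Near `0`, the alternating geometric series of `tA` is a left inverse of `1 + tA`. -/
theorem exists_tsum_mul_one_add_eq_one (A : Fin q → Matrix (Fin p) (Fin p) ℝ) :
    ∃ ε > (0 : ℝ), ∀ t : Fin q → ℝ, ‖t‖ < ε →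
      (∑' s : ℕ, (-1 : ℝ) ^ s • (∑ α, t α • A α) ^ s) * (1 + ∑ α, t α • A α) = 1 := by
  let _ : NormedRing (Matrix (Fin p) (Fin p) ℝ) := Matrix.linftyOpNormedRing
  let _ : NormedAlgebra ℝ (Matrix (Fin p) (Fin p) ℝ) := Matrix.linftyOpNormedAlgebra
  have hcont : Continuous fun t : Fin q → ℝ => ‖-∑ α, t α • A α‖ := by fun_prop
  have hev : ∀ᶠ t in nhds (0 : Fin q → ℝ), ‖-∑ α, t α • A α‖ < 1 :=
    hcont.continuousAt.eventually_lt continuousAt_const (by simp)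
  obtain ⟨ε, hε, h⟩ := Metric.eventually_nhds_iff.1 hev
  refine ⟨ε, hε, fun t ht => ?_⟩
  have := geom_series_mul_neg _ (h (by simpa using ht))
  rw [sub_neg_eq_add] at this
  simp_rw [← smul_pow, neg_smul, one_smul]
  exact this

theorem statement_3 (hq : 1 ≤ q) (A : Fin q → Matrix (Fin p) (Fin p) ℝ)
    (𝓐 : ℝ → Fin q → Matrix (Fin p) (Fin p) ℝ) (𝓐' : Fin q → Matrix (Fin p) (Fin p) ℝ)
    (h0 : 𝓐 0 = A)
    (hderiv : ∀ α i j, HasDerivAt (fun τ => 𝓐 τ α i j) (𝓐' α i j) 0) :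
    ∃ ε > (0 : ℝ), ∀ t : Fin q → ℝ, ‖t‖ < ε →
      HasDerivAt (fun τ => Matrix.det (1 + ∑ α, t α • 𝓐 τ α))
        (Matrix.trace ((∑ α, t α • 𝓐' α) *
            ∑' s : ℕ, (-1 : ℝ) ^ s • ∑ c : Fin s → Fin q,
              (∏ α, t α ^ wt c α) • prodSeq A c) *
          Matrix.det (1 + ∑ α, t α • A α)) 0 := by
  obtain ⟨ε, hε, h⟩ := exists_tsum_mul_one_add_eq_one A
  refine ⟨ε, hε, fun t ht => ?_⟩
  simp_rw [sum_smul_prodSeq]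
  have hS := h t ht
  set S := ∑' s : ℕ, (-1 : ℝ) ^ s • (∑ α, t α • A α) ^ s
  have hd : HasDerivAt (fun τ => Matrix.det (1 + ∑ α, t α • 𝓐 τ α))
      ((∑ α, t α • 𝓐' α) * (1 + ∑ α, t α • 𝓐 0 α).adjugate).trace 0 := by
    refine Matrix.hasDerivAt_det fun i j => ?_
    simp only [Matrix.add_apply, Matrix.sum_apply, Matrix.smul_apply, smul_eq_mul]
    exact (HasDerivAt.fun_sum fun α _ => (hderiv α i j).const_mul (t α)).const_add _
  rw [h0] at hd
  convert hd using 1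
  have hadj : (1 + ∑ α, t α • A α).adjugate = (1 + ∑ α, t α • A α).det • S := by
    generalize 1 + ∑ α, t α • A α = N at hS
    rw [← Matrix.one_mul N.adjugate, ← hS, Matrix.mul_assoc, Matrix.mul_adjugate,
      Matrix.mul_smul, Matrix.mul_one]
  rw [hadj, Matrix.mul_smul, Matrix.trace_smul, smul_eq_mul, mul_comm]

end GNTPaper
end

section
/- Let A = (A_1,…,A_q) be a system of endomorphisms of the p-dimensional space V. For every multi-index u ∈ ℕ^q, the trace of the generalized Newton transformation satisfies tr T_u(A) = (p − |u|)·σ_u(A). -/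
open scoped BigOperators

namespace GNTPaper

variable {p q : ℕ}

theorem derivation_prod {R S ι : Type*} [CommRing R] [CommRing S] [Algebra R S] [DecidableEq ι]
    (D : Derivation R S S) (s : Finset ι) (f : ι → S) :
    D (∏ i ∈ s, f i) = ∑ i ∈ s, (∏ j ∈ s.erase i, f j) * D (f i) := by
  induction s using Finset.induction_on with
  | empty => simp
  | insert a s ha ih =>
    rw [Finset.prod_insert ha, D.leibniz, ih, Finset.sum_insert ha, Finset.erase_insert ha,
      add_comm, smul_eq_mul, smul_eq_mul, Finset.mul_sum]
    congr 1
    refine Finset.sum_congr rfl fun i hi => ?_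
    have hai : a ≠ i := fun h => ha (h ▸ hi)
    rw [Finset.erase_insert_of_ne hai,
      Finset.prod_insert (fun h => ha (Finset.mem_of_mem_erase h)), mul_assoc]

/-- Jacobi's formula for an arbitrary derivation. -/
theorem derivation_det {R S n : Type*} [CommRing R] [CommRing S] [Algebra R S] [Fintype n]
    [DecidableEq n] (D : Derivation R S S) (M : Matrix n n S) :
    D M.det = (M.adjugate * M.map D).trace := by
  have hdet : ∀ i, (M.adjugate * M.map D) i i = (M.updateCol i fun k => D (M k i)).det := by
    intro i
    rw [← Matrix.cramer_apply, Matrix.cramer_eq_adjugate_mulVec]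
    rfl
  simp only [Matrix.trace, Matrix.diag_apply, hdet]
  simp only [Matrix.det_apply, map_sum]
  rw [Finset.sum_comm]
  refine Finset.sum_congr rfl fun σ _ => ?_
  rw [← Finset.smul_sum, Units.smul_def, Units.smul_def, map_zsmul, derivation_prod]
  congr 1
  refine Finset.sum_congr rfl fun i _ => ?_
  rw [← Finset.prod_erase_mul _ _ (Finset.mem_univ i), Matrix.updateCol_self]
  congr 1
  refine Finset.prod_congr rfl fun j hj => ?_
  rw [Matrix.updateCol_ne (Finset.ne_of_mem_erase hj)]

/-- The Euler operator multiplies each monomial by its degree. -/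
theorem coeff_mkDerivation_X {R ι : Type*} [CommRing R] (P : MvPolynomial ι R) (m : ι →₀ ℕ) :
    MvPolynomial.coeff m (MvPolynomial.mkDerivation R MvPolynomial.X P) =
      (m.degree : R) * MvPolynomial.coeff m P := by
  classical
  induction P using MvPolynomial.induction_on' with
  | add P Q hP hQ => simp [hP, hQ, mul_add]
  | monomial v r =>
    have hterm : ∀ i ∈ v.support,
        MvPolynomial.monomial (v - Finsupp.single i 1) (v i : R) • (MvPolynomial.X i) =
          MvPolynomial.monomial v (v i : R) := by
      intro i hi
      have hle : Finsupp.single i 1 ≤ v := by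
        simpa [Nat.one_le_iff_ne_zero] using hi
      rw [smul_eq_mul, MvPolynomial.X, MvPolynomial.monomial_mul, mul_one,
        tsub_add_cancel_of_le hle]
    rw [MvPolynomial.mkDerivation_monomial, Finsupp.sum, Finset.sum_congr rfl hterm]
    simp only [MvPolynomial.coeff_smul, MvPolynomial.coeff_sum, MvPolynomial.coeff_monomial]
    split_ifs with h
    · subst h
      simp [Finsupp.degree_apply, mul_comm]
    · simp

/-- The generic linear combination `tA`, with polynomial entries. -/
noncomputable def genericMatrix (A : Fin q → Matrix (Fin p) (Fin p) ℝ) :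
    Matrix (Fin p) (Fin p) (MvPolynomial (Fin q) ℝ) :=
  ∑ α : Fin q, (MvPolynomial.X α : MvPolynomial (Fin q) ℝ) • (A α).map MvPolynomial.C

theorem newtonMvPoly_eq_det (A : Fin q → Matrix (Fin p) (Fin p) ℝ) :
    newtonMvPoly A = (1 + genericMatrix A).det := rfl

theorem mkDerivation_X_one_add_genericMatrix (A : Fin q → Matrix (Fin p) (Fin p) ℝ) :
    (1 + genericMatrix A).map (MvPolynomial.mkDerivation ℝ MvPolynomial.X) =
      genericMatrix A := by
  ext i j : 1
  have hone : MvPolynomial.mkDerivation ℝ (MvPolynomial.X (σ := Fin q) (R := ℝ))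
      ((1 : Matrix (Fin p) (Fin p) (MvPolynomial (Fin q) ℝ)) i j) = 0 := by
    by_cases h : i = j <;> simp [Matrix.one_apply, h]
  simp only [Matrix.map_apply, Matrix.add_apply, map_add, hone, zero_add]
  simp [genericMatrix, Matrix.sum_apply, Derivation.leibniz, mul_comm]

theorem trace_adjugate_one_add_genericMatrix (A : Fin q → Matrix (Fin p) (Fin p) ℝ) :
    (1 + genericMatrix A).adjugate.trace = (p : MvPolynomial (Fin q) ℝ) * newtonMvPoly A -
      MvPolynomial.mkDerivation ℝ MvPolynomial.X (newtonMvPoly A) := by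
  have h := congrArg Matrix.trace (Matrix.adjugate_mul (1 + genericMatrix A))
  rw [mul_add, mul_one, Matrix.trace_add, Matrix.trace_smul, Matrix.trace_one,
    Fintype.card_fin, smul_eq_mul] at h
  rw [newtonMvPoly_eq_det, derivation_det, mkDerivation_X_one_add_genericMatrix, mul_comm, ← h,
    add_sub_cancel_right]

theorem genericMatrix_pow (A : Fin q → Matrix (Fin p) (Fin p) ℝ) (s : ℕ) :
    genericMatrix A ^ s = ∑ c : Fin s → Fin q,
      (∏ l, MvPolynomial.X (c l) : MvPolynomial (Fin q) ℝ) •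
        (prodSeq A c).map MvPolynomial.C := by
  induction s with
  | zero => simp [prodSeq, Matrix.map_one MvPolynomial.C (map_zero _) (map_one _)]
  | succ s ih =>
    rw [pow_succ', ih, ← (Fin.consEquiv fun _ => Fin q).sum_comp, Fintype.sum_prod_type,
      genericMatrix, Finset.sum_mul_sum]
    refine Finset.sum_congr rfl fun α _ => Finset.sum_congr rfl fun c _ => ?_
    simp [Fin.consEquiv, prodSeq, Fin.prod_univ_succ, List.ofFn_succ, smul_smul,
      mul_comm, Matrix.map_mul]

theorem prod_X_eq_monomial_wt {s : ℕ} (c : Fin s → Fin q) :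
    (∏ l, MvPolynomial.X (c l) : MvPolynomial (Fin q) ℝ) =
      MvPolynomial.monomial (Finsupp.equivFunOnFinite.symm (wt c)) 1 := by
  have hwt : Finsupp.equivFunOnFinite.symm (wt c) = ∑ l, Finsupp.single (c l) 1 := by
    ext α
    simp [wt, Finsupp.single_apply]
  rw [hwt, MvPolynomial.monomial_sum_one]
  rfl

theorem sum_wt {s : ℕ} (c : Fin s → Fin q) : ∑ α, wt c α = s := by
  simpa [wt] using
    (Finset.card_eq_sum_card_fiberwise (f := c) (s := Finset.univ) (t := Finset.univ)
      (by simp)).symm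

theorem coeff_prod_X_mul (u : Fin q → ℕ) {s : ℕ} (c : Fin s → Fin q)
    (P : MvPolynomial (Fin q) ℝ) :
    MvPolynomial.coeff (Finsupp.equivFunOnFinite.symm u) ((∏ l, MvPolynomial.X (c l)) * P) =
      if ∀ α, wt c α ≤ u α then
        MvPolynomial.coeff (Finsupp.equivFunOnFinite.symm fun α => u α - wt c α) P
      else 0 := by
  classical
  rw [prod_X_eq_monomial_wt, mul_comm, MvPolynomial.coeff_mul_monomial', mul_one]
  exact if_congr Iff.rfl (congrArg (MvPolynomial.coeff · P) (by ext; simp)) rfl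

theorem coeff_trace_mul_genericMatrix_pow_eq_zero (A : Fin q → Matrix (Fin p) (Fin p) ℝ)
    (u : Fin q → ℕ) {s : ℕ} (hs : ∑ α, u α < s)
    (B : Matrix (Fin p) (Fin p) (MvPolynomial (Fin q) ℝ)) :
    MvPolynomial.coeff (Finsupp.equivFunOnFinite.symm u) (B * genericMatrix A ^ s).trace = 0 := by
  rw [genericMatrix_pow, Finset.mul_sum, Matrix.trace_sum, MvPolynomial.coeff_sum]
  refine Finset.sum_eq_zero fun c _ => ?_
  rw [Matrix.mul_smul, Matrix.trace_smul, smul_eq_mul, coeff_prod_X_mul, if_neg]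
  intro h
  have := Finset.sum_le_sum fun α (_ : α ∈ Finset.univ) => h α
  rw [sum_wt] at this
  omega

theorem coeff_newtonMvPoly_mul_trace_genericMatrix_pow (A : Fin q → Matrix (Fin p) (Fin p) ℝ)
    (u : Fin q → ℕ) (s : ℕ) :
    MvPolynomial.coeff (Finsupp.equivFunOnFinite.symm u)
        (newtonMvPoly A * (genericMatrix A ^ s).trace) =
      ∑ c : Fin s → Fin q, sigmaSub A u c * (prodSeq A c).trace := by
  rw [genericMatrix_pow, Matrix.trace_sum, Finset.mul_sum, MvPolynomial.coeff_sum]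
  refine Finset.sum_congr rfl fun c _ => ?_
  have htrace : ((prodSeq A c).map (MvPolynomial.C (σ := Fin q))).trace =
      MvPolynomial.C (prodSeq A c).trace := by
    simp [Matrix.trace]
  rw [Matrix.trace_smul, smul_eq_mul, htrace, mul_left_comm, coeff_prod_X_mul,
    mul_comm (newtonMvPoly A)]
  simp only [MvPolynomial.coeff_C_mul, sigmaSub, sigma, ite_mul, zero_mul, mul_comm (Matrix.trace _)]

/-- `T_u(A)` and the coefficient of `t^u` in the adjugate of `1 + tA` have the same trace. -/
theorem trace_gnt (A : Fin q → Matrix (Fin p) (Fin p) ℝ) (u : Fin q → ℕ) :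
    (gnt A u).trace = MvPolynomial.coeff (Finsupp.equivFunOnFinite.symm u)
      (1 + genericMatrix A).adjugate.trace := by
  set N := genericMatrix A with hN
  set n := (∑ α, u α) + 1 with hn
  have hgeom : newtonMvPoly A • ∑ s ∈ Finset.range n, (-N) ^ s =
      (1 + N).adjugate - (1 + N).adjugate * (-N) ^ n := by
    have h := mul_neg_geom_sum (-N) n
    rw [sub_neg_eq_add] at h
    rw [newtonMvPoly_eq_det, ← hN, ← Matrix.one_mul (∑ s ∈ Finset.range n, (-N) ^ s),
      ← Matrix.smul_mul, ← Matrix.adjugate_mul, Matrix.mul_assoc, h, mul_sub, mul_one]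
  have hcoeff := congrArg
    (fun M => MvPolynomial.coeff (Finsupp.equivFunOnFinite.symm u) (Matrix.trace M)) hgeom
  have hzero : MvPolynomial.coeff (Finsupp.equivFunOnFinite.symm u)
      ((1 + N).adjugate * (-N) ^ n).trace = 0 := by
    rw [neg_pow, ← mul_assoc]
    exact coeff_trace_mul_genericMatrix_pow_eq_zero A u (Nat.lt_succ_self _) _
  simp only [Matrix.trace_sub, MvPolynomial.coeff_sub, hzero, sub_zero] at hcoeff
  rw [← hcoeff, gnt, Matrix.trace_smul, Matrix.trace_sum, Matrix.trace_sum, smul_eq_mul,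
    Finset.mul_sum, MvPolynomial.coeff_sum]
  refine Finset.sum_congr rfl fun s _ => ?_
  have hneg : (-N) ^ s = (MvPolynomial.C ((-1) ^ s) : MvPolynomial (Fin q) ℝ) • N ^ s := by
    rw [← neg_one_smul (MvPolynomial (Fin q) ℝ) N, smul_pow]
    simp
  rw [hneg, Matrix.trace_smul (MvPolynomial.C _), smul_eq_mul, mul_left_comm,
    MvPolynomial.coeff_C_mul, coeff_newtonMvPoly_mul_trace_genericMatrix_pow,
    Matrix.trace_smul, Matrix.trace_sum, smul_eq_mul]
  simp only [Matrix.trace_smul, smul_eq_mul]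

theorem statement_7 (hq : 1 ≤ q) (A : Fin q → Matrix (Fin p) (Fin p) ℝ) (u : Fin q → ℕ) :
    Matrix.trace (gnt A u) = ((p : ℝ) - ((∑ α, u α : ℕ) : ℝ)) * sigma A u := by
  rw [trace_gnt, trace_adjugate_one_add_genericMatrix, MvPolynomial.coeff_sub,
    coeff_mkDerivation_X, ← map_natCast MvPolynomial.C, MvPolynomial.coeff_C_mul,
    Finsupp.degree_eq_sum, sigma, sub_mul]
  rfl

end GNTPaper
end

section
/- Let A = (A_1,…,A_q) be a system of endomorphisms of V. If every A_α is self-adjoint with respect to the inner product on V (i.e. A_α^⊤ = A_α for all α), then the generalized Newton transformation T_u(A) is self-adjoint for every multi-index u ∈ ℕ^q. -/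
open scoped BigOperators

namespace GNTPaper

variable {p q : ℕ}

/-- Reversing the columns of `i ∈ I(q,s)` preserves its weight. -/
theorem wt_comp_rev {s : ℕ} (c : Fin s → Fin q) : wt (c ∘ Fin.rev) = wt c := by
  funext α
  exact Finset.card_equiv Fin.revPerm (by simp)

theorem sigmaSub_comp_rev (A : Fin q → Matrix (Fin p) (Fin p) ℝ) (u : Fin q → ℕ)
    {s : ℕ} (c : Fin s → Fin q) : sigmaSub A u (c ∘ Fin.rev) = sigmaSub A u c := by
  simp only [sigmaSub, wt_comp_rev]

/-- For symmetric matrices, transposing an ordered composition reverses it. -/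
theorem transpose_prodSeq (A : Fin q → Matrix (Fin p) (Fin p) ℝ)
    (hA : ∀ α, Matrix.transpose (A α) = A α) {s : ℕ} (c : Fin s → Fin q) :
    Matrix.transpose (prodSeq A c) = prodSeq A (c ∘ Fin.rev) := by
  have hrev : (List.ofFn fun l => A (c l)).reverse = List.ofFn fun l => A ((c ∘ Fin.rev) l) := by
    apply List.ext_getElem
    · simp
    · intro n h₁ h₂
      simp only [List.getElem_reverse, List.getElem_ofFn, Function.comp_apply, List.length_ofFn]
      congr 2
      ext
      simp [Fin.val_rev]
      omega
  rw [prodSeq, prodSeq, Matrix.transpose_list_prod, List.map_ofFn, ← hrev]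
  simp [Function.comp_def, hA]

theorem statement_9 (hq : 1 ≤ q) (A : Fin q → Matrix (Fin p) (Fin p) ℝ)
    (hA : ∀ α, Matrix.transpose (A α) = A α) :
    ∀ u : Fin q → ℕ, Matrix.transpose (gnt A u) = gnt A u := by
  intro u
  simp only [gnt, Matrix.transpose_sum, Matrix.transpose_smul]
  refine Finset.sum_congr rfl fun s _ => congrArg _ ?_
  refine Fintype.sum_equiv (Equiv.arrowCongr Fin.revPerm (Equiv.refl _)) _ _ fun c => ?_
  change _ = sigmaSub A u (c ∘ Fin.rev) • prodSeq A (c ∘ Fin.rev)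
  rw [transpose_prodSeq A hA, sigmaSub_comp_rev]

end GNTPaper
end
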